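/- (Solvability of Runge–Kutta methods, Proposition 4.2.) Let n, s ≥ 1, d ≥ 0, and let V₀, …, V_d : ℝⁿ → ℝⁿ be continuous maps that are uniformly bounded: ‖V_i(y)‖ ≤ ν for all y ∈ ℝⁿ and all i = 0, …, d. Let a = (a_{αβ})_{α,β=1,…,s} be real coefficients with |a_{αβ}| ≤ c for all α, β, let Y ∈ ℝⁿ, and let ξ = (ξ₀, …, ξ_d) ∈ ℝ^{d+1}. Then there exist Z₁, …, Z_s ∈ ℝⁿ satisfying the stage equations Z_α = Y + ∑_{β=1}^{s} a_{αβ} ∑_{i=0}^{d} ξᵢ Vᵢ(Z_β) for all α = 1, …, s; moreover, such a solution exists with (∑_{α=1}^{s} ‖Z_α‖²)^{1/2} ≤ √s ‖Y‖ + s² c ν ∑_{i=0}^{d} |ξᵢ| + 1. -/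

import Mathlib

open MeasureTheory Filter Topology Metric Set Polynomial
open scoped NNReal

/-- The ring homomorphism evaluating a polynomial with continuous function coefficients as a
function of the parameter and of the point. -/
noncomputable def polyFamilyHom (E : Type*) [TopologicalSpace E] :
    C(E, ℝ)[X] →+* (ℝ → E → ℝ) :=
  RingHom.pi fun t => RingHom.pi fun x =>
    eval₂RingHom (RingHomClass.toRingHom (ContinuousMap.evalAlgHom ℝ ℝ x)) t

theorem polyFamilyHom_apply {E : Type*} [TopologicalSpace E] (p : C(E, ℝ)[X]) (t : ℝ) (x : E) :
    polyFamilyHom E p t x = ∑ i ∈ Finset.range (p.natDegree + 1), p.coeff i x * t ^ i := by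
  simp [polyFamilyHom, RingHom.pi, eval₂_eq_sum_range]

/-- The functions of a parameter and a point that are polynomial in the parameter, with
coefficients continuous in the point. -/
noncomputable def polyFamily (E : Type*) [TopologicalSpace E] : Subring (ℝ → E → ℝ) :=
  (polyFamilyHom E).range

theorem continuous_mem_polyFamily {E : Type*} [TopologicalSpace E] {f : E → ℝ}
    (hf : Continuous f) : (fun _ x => f x) ∈ polyFamily E :=
  ⟨C ⟨f, hf⟩, by ext t x; simp [polyFamilyHom, RingHom.pi]⟩

theorem param_mem_polyFamily (E : Type*) [TopologicalSpace E] :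
    (fun t _ => t) ∈ polyFamily E :=
  ⟨X, by ext t x; simp [polyFamilyHom, RingHom.pi]⟩

theorem polyFamily_continuous {E : Type*} [TopologicalSpace E] {h : ℝ → E → ℝ}
    (hh : h ∈ polyFamily E) : Continuous fun z : ℝ × E => h z.1 z.2 := by
  obtain ⟨p, rfl⟩ := hh
  simp only [polyFamilyHom_apply]
  fun_prop

theorem polyFamily_exists_setIntegral_eq_eval {E : Type*} [TopologicalSpace E] [T2Space E]
    [MeasurableSpace E] [OpensMeasurableSpace E] (μ : Measure E) [IsFiniteMeasureOnCompacts μ]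
    {K : Set E} (hK : IsCompact K) {h : ℝ → E → ℝ} (hh : h ∈ polyFamily E) :
    ∃ P : ℝ[X], ∀ t, ∫ x in K, h t x ∂μ = P.eval t := by
  obtain ⟨p, rfl⟩ := hh
  refine ⟨∑ i ∈ Finset.range (p.natDegree + 1), C (∫ x in K, p.coeff i x ∂μ) * X ^ i, fun t => ?_⟩
  simp only [polyFamilyHom_apply, eval_finsetSum, eval_mul, eval_C, eval_pow, eval_X]
  rw [integral_finsetSum]
  · simp [integral_mul_const]
  · intro i _
    exact (((p.coeff i).continuous.mul continuous_const).continuousOn).integrableOn_compact hK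

section

variable {E : Type*} [NormedAddCommGroup E] [InnerProductSpace ℝ E]

theorem one_sub_normSq_pow_mem_polyFamily {F : E → E} (hF : Continuous F) (c : ℝ) (k : ℕ) :
    (fun (t : ℝ) x => (1 - c * ‖x - t • F x‖ ^ 2) ^ k) ∈ polyFamily E := by
  have key : (fun (t : ℝ) x => (1 - c * ‖x - t • F x‖ ^ 2) ^ k) =
      ((fun _ _ => 1) - (fun _ _ => c) * ((fun _ x => ‖x‖ ^ 2)
        - (fun t _ => t) * (fun _ x => 2 * inner ℝ x (F x))
        + (fun t _ => t) * (fun t _ => t) * (fun _ x => ‖F x‖ ^ 2))) ^ k := by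
    ext t x
    simp only [Pi.pow_apply, Pi.sub_apply, Pi.mul_apply, Pi.add_apply]
    rw [norm_sub_sq_real, inner_smul_right, norm_smul, mul_pow, Real.norm_eq_abs, sq_abs]
    ring
  rw [key]
  have ht := param_mem_polyFamily E
  refine pow_mem (sub_mem (continuous_mem_polyFamily continuous_const)
    (mul_mem (continuous_mem_polyFamily continuous_const) (add_mem (sub_mem ?_ (mul_mem ht ?_))
      (mul_mem (mul_mem ht ht) ?_)))) k <;>
  exact continuous_mem_polyFamily (by fun_prop)

theorem image_id_sub_smul_eq {F : E → E} {K : Set E} (hK : ∀ x ∉ K, F x = 0) {t : ℝ}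
    (hb : Function.Bijective fun x => x - t • F x) : (fun x => x - t • F x) '' K = K := by
  have hout (x : E) (hx : x ∉ K) : x - t • F x = x := by simp [hK x hx]
  apply Subset.antisymm
  · rintro _ ⟨x, hx, rfl⟩
    by_contra hy
    exact hy (by simpa [hb.1 (hout _ hy)] using hx)
  · intro y hy
    obtain ⟨x, rfl⟩ := hb.2 y
    refine ⟨x, ?_, rfl⟩
    by_contra hx
    exact hx (by simpa [hout x hx] using hy)

variable [FiniteDimensional ℝ E]

theorem det_id_sub_smul_mem_polyFamily {X : Type*} [TopologicalSpace X] {A : X → E →L[ℝ] E}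
    (hA : Continuous A) :
    (fun t x => (ContinuousLinearMap.id ℝ E - t • A x).det) ∈ polyFamily X := by
  classical
  let b := stdOrthonormalBasis ℝ E
  have key : (fun t x => (ContinuousLinearMap.id ℝ E - t • A x).det) =
      ∑ σ : Equiv.Perm (Fin (Module.finrank ℝ E)),
        (fun _ _ => ((Equiv.Perm.sign σ : ℤ) : ℝ)) *
        ∏ i, (fun (t : ℝ) (x : X) =>
          (if σ i = i then 1 else 0) - t * inner ℝ (b (σ i)) (A x (b i))) := by
    ext t x
    rw [ContinuousLinearMap.det, ← LinearMap.det_toMatrix b.toBasis, Matrix.det_apply']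
    simp [Finset.sum_apply, Finset.prod_apply, LinearMap.toMatrix_apply, b.repr_apply_apply]
  rw [key]
  refine sum_mem fun σ _ => mul_mem (continuous_mem_polyFamily continuous_const)
    (prod_mem fun i _ => ?_)
  exact sub_mem (continuous_mem_polyFamily continuous_const)
    (mul_mem (param_mem_polyFamily X) (continuous_mem_polyFamily (by fun_prop)))

theorem bijective_id_sub_smul {F : E → E} {L : ℝ≥0} (hF : LipschitzWith L F) {t : ℝ}
    (ht : ‖t‖₊ * L < 1) : Function.Bijective fun x => x - t • F x := by
  have hc (y : E) : ContractingWith (‖t‖₊ * L) fun x => y + t • F x := by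
    refine ⟨ht, LipschitzWith.of_dist_le_mul fun u v => ?_⟩
    rw [dist_add_left, dist_smul₀]
    simpa [mul_assoc] using mul_le_mul_of_nonneg_left (hF.dist_le_mul u v) (norm_nonneg t)
  refine ⟨fun u v huv => ?_, fun y => ⟨(hc y).fixedPoint, ?_⟩⟩
  · refine (hc (u - t • F u)).fixedPoint_unique' (x := u) (y := v) ?_ ?_
    · simp [Function.IsFixedPt]
    · change u - t • F u + t • F v = v
      rw [show u - t • F u = v - t • F v from huv, sub_add_cancel]
  · have := (hc y).fixedPoint_isFixedPt
    exact sub_eq_of_eq_add this.symm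

/-- Change of variables for `x ↦ x - F x` with `F` compactly supported. It holds for `x ↦ x - t F x`
with small `t`, where the map is a diffeomorphism, and both sides are polynomial in `t`. -/
theorem setIntegral_comp_id_sub_mul_det [MeasurableSpace E] [BorelSpace E] (μ : Measure E)
    [μ.IsAddHaarMeasure] {F : E → E} (hF : ContDiff ℝ 1 F) (hs : HasCompactSupport F)
    {K : Set E} (hK : IsCompact K) (hFK : ∀ x ∉ K, F x = 0) (c : ℝ) (k : ℕ) :
    ∫ x in K, (1 - c * ‖x - F x‖ ^ 2) ^ k * (ContinuousLinearMap.id ℝ E - fderiv ℝ F x).det ∂μ =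
      ∫ x in K, (1 - c * ‖x‖ ^ 2) ^ k ∂μ := by
  have hdet := det_id_sub_smul_mem_polyFamily (hF.continuous_fderiv one_ne_zero)
  obtain ⟨P, hP⟩ := polyFamily_exists_setIntegral_eq_eval μ hK
    (mul_mem (one_sub_normSq_pow_mem_polyFamily hF.continuous c k) hdet)
  obtain ⟨L, hL⟩ := hF.lipschitzWith_of_hasCompactSupport hs one_ne_zero
  have hsmall : ∀ᶠ t : ℝ in 𝓝 0, ‖t‖₊ * L < 1 :=
    (by fun_prop : Continuous fun t : ℝ => ‖t‖₊ * L).continuousAt.eventually_lt_const (by simp)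
  have hpos : ∀ᶠ t : ℝ in 𝓝 0, ∀ x ∈ K,
      0 < (ContinuousLinearMap.id ℝ E - t • fderiv ℝ F x).det :=
    hK.eventually_forall_of_forall_eventually fun x _ =>
      (polyFamily_continuous hdet).continuousAt.eventually_const_lt
        (by simp [ContinuousLinearMap.det])
  have heq : ∀ᶠ t : ℝ in 𝓝 0, P.eval t = (C (∫ x in K, (1 - c * ‖x‖ ^ 2) ^ k ∂μ)).eval t := by
    filter_upwards [hsmall, hpos] with t ht htpos
    have hb := bijective_id_sub_smul hL ht
    rw [← hP, eval_C]
    conv_rhs => rw [← image_id_sub_smul_eq hFK hb]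
    rw [integral_image_eq_integral_abs_det_fderiv_smul μ hK.measurableSet
      (f' := fun x => ContinuousLinearMap.id ℝ E - t • fderiv ℝ F x)
      (fun x _ => ?_) hb.1.injOn]
    · refine setIntegral_congr_fun hK.measurableSet fun x hx => ?_
      simp [abs_of_pos (htpos x hx), mul_comm]
    · exact ((hasFDerivAt_id x).sub
        (((hF.differentiable one_ne_zero) x).hasFDerivAt.const_smul t)).hasFDerivWithinAt
  have hPC := eq_of_infinite_eval_eq P _ (infinite_of_mem_nhds 0 heq)
  simpa [hPC] using hP 1

/-- A compactly supported `C¹` self-map of a Euclidean space has a fixed point: otherwise testing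
the change of variables `x ↦ x - F x` against powers of `1 - ‖x‖² / M²`, which concentrate near the
origin, gives a contradiction. -/
theorem ContDiff.exists_fixedPoint_of_hasCompactSupport {F : E → E} (hF : ContDiff ℝ 1 F)
    (hs : HasCompactSupport F) : ∃ x, F x = x := by
  by_contra! hne
  borelize E
  let μ : Measure E := Measure.addHaar
  obtain ⟨R, hR0, hR⟩ := hs.isCompact.isBounded.subset_closedBall_lt 0 0
  set K := closedBall (0 : E) R with hKdef
  have hK : IsCompact K := isCompact_closedBall 0 R
  have hFK (x : E) (hx : x ∉ K) : F x = 0 := image_eq_zero_of_notMem_tsupport fun h => hx (hR h)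
  have hK0 : (0 : E) ∈ K := mem_closedBall_self hR0.le
  have hc : Continuous fun x => ‖x - F x‖ := by
    have := hF.continuous
    fun_prop
  obtain ⟨u, -, hu⟩ := hK.exists_isMinOn ⟨0, hK0⟩ hc.continuousOn
  obtain ⟨C, hC⟩ := hK.bddAbove_image hc.continuousOn
  obtain ⟨D, hD⟩ := hK.bddAbove_image
    (f := fun x => |(ContinuousLinearMap.id ℝ E - fderiv ℝ F x).det|)
    (by
      have := (polyFamily_continuous (det_id_sub_smul_mem_polyFamily
        (hF.continuous_fderiv one_ne_zero))).comp (Continuous.prodMk_right (1 : ℝ))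
      simpa [Function.comp_def] using this.abs.continuousOn)
  set ε := ‖u - F u‖
  have hε : 0 < ε := norm_pos_iff.2 (sub_ne_zero.2 (hne u).symm)
  set δ := min (ε / 2) R
  have hδ : 0 < δ := by positivity
  have hδε : δ < ε := (min_le_left _ _).trans_lt (by linarith)
  set M := max C R
  have hM : 0 < M := hR0.trans_le (le_max_right _ _)
  have hεM : ε ≤ M := (hu hK0).trans ((hC ⟨0, hK0, rfl⟩).trans (le_max_left _ _))
  set q := 1 - (M ^ 2)⁻¹ * ε ^ 2
  set r := 1 - (M ^ 2)⁻¹ * δ ^ 2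
  have hnn (a : ℝ) (ha : 0 ≤ a) (haM : a ≤ M) : 0 ≤ 1 - (M ^ 2)⁻¹ * a ^ 2 := by
    rw [sub_nonneg, inv_mul_le_one₀ (by positivity)]
    gcongr
  have hq : 0 ≤ q := hnn ε hε.le hεM
  have hqr : q < r := by
    have : (M ^ 2)⁻¹ * δ ^ 2 < (M ^ 2)⁻¹ * ε ^ 2 := by gcongr
    simp only [q, r]; linarith
  have hr : 0 < r := hq.trans_lt hqr
  have hupper (k : ℕ) : ∫ x in K, (1 - (M ^ 2)⁻¹ * ‖x - F x‖ ^ 2) ^ k *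
      (ContinuousLinearMap.id ℝ E - fderiv ℝ F x).det ∂μ ≤ q ^ k * D * μ.real K := by
    refine (Real.le_norm_self _).trans (norm_setIntegral_le_of_norm_le_const hK.measure_lt_top
      fun x hx => ?_)
    have h1 := hnn _ (norm_nonneg (x - F x)) ((hC ⟨x, hx, rfl⟩).trans (le_max_left _ _))
    rw [norm_mul, norm_pow, Real.norm_of_nonneg h1]
    have h2 : ε ≤ ‖x - F x‖ := hu hx
    have h3 := hD ⟨x, hx, rfl⟩
    gcongr
    · simp only [q]; gcongr
    · exact h3
  have hlower (k : ℕ) : r ^ k * μ.real (closedBall (0 : E) δ) ≤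
      ∫ x in K, (1 - (M ^ 2)⁻¹ * ‖x‖ ^ 2) ^ k ∂μ := by
    have hi : IntegrableOn (fun x => (1 - (M ^ 2)⁻¹ * ‖x‖ ^ 2) ^ k) K μ :=
      ContinuousOn.integrableOn_compact hK (by fun_prop)
    have hsub : closedBall (0 : E) δ ⊆ K := closedBall_subset_closedBall (min_le_right _ _)
    calc r ^ k * μ.real (closedBall (0 : E) δ) = ∫ x in closedBall (0 : E) δ, r ^ k ∂μ := by
          simp [mul_comm]
      _ ≤ ∫ x in closedBall (0 : E) δ, (1 - (M ^ 2)⁻¹ * ‖x‖ ^ 2) ^ k ∂μ := by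
          refine setIntegral_mono_on (integrableOn_const (isCompact_closedBall 0 δ).measure_lt_top.ne)
            (hi.mono_set hsub) measurableSet_closedBall fun x hx => ?_
          have : ‖x‖ ≤ δ := by simpa using hx
          simp only [r] at hr ⊢
          gcongr
      _ ≤ _ := by
          refine setIntegral_mono_set hi ?_ hsub.eventuallyLE
          filter_upwards [ae_restrict_mem hK.measurableSet] with x hx
          have : ‖x‖ ≤ R := by simpa [hKdef] using hx
          exact pow_nonneg (hnn _ (norm_nonneg x) (this.trans (le_max_right _ _))) k
  have hle (k : ℕ) : μ.real (closedBall (0 : E) δ) ≤ (q / r) ^ k * (D * μ.real K) := by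
    have := (hlower k).trans ((setIntegral_comp_id_sub_mul_det μ hF hs hK hFK _ k).symm.le.trans
      (hupper k))
    rw [div_pow, div_mul_eq_mul_div, le_div_iff₀ (by positivity)]
    linarith
  have hlim : Tendsto (fun k : ℕ => (q / r) ^ k * (D * μ.real K)) atTop (𝓝 0) := by
    simpa using (tendsto_pow_atTop_nhds_zero_of_lt_one (by positivity)
      ((div_lt_one hr).2 hqr)).mul_const (D * μ.real K)
  have hvol : 0 < μ.real (closedBall (0 : E) δ) :=
    ENNReal.toReal_pos (measure_closedBall_pos μ 0 hδ).ne'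
      (isCompact_closedBall 0 δ).measure_lt_top.ne
  exact (ge_of_tendsto' hlim hle).not_gt hvol

/-- A bounded continuous self-map of a Euclidean space has a fixed point. -/
theorem Continuous.exists_fixedPoint_of_bounded {F : E → E} (hF : Continuous F) {M : ℝ}
    (hM : ∀ x, ‖F x‖ ≤ M) : ∃ x, F x = x := by
  have hM0 : 0 ≤ M := (norm_nonneg _).trans (hM 0)
  have happrox (ε : ℝ) (hε : 0 < ε) (hε1 : ε ≤ 1) :
      ∃ x ∈ closedBall (0 : E) (M + 1), ‖F x - x‖ < ε := by
    obtain ⟨g, hg, hgF, -⟩ := hF.exists_contDiff_approx 1 (ε := fun _ => ε) continuous_const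
      fun _ => hε
    have hgM (x : E) : ‖g x‖ ≤ M + 1 := by
      have h1 : ‖g x - F x‖ < ε := by simpa [dist_eq_norm] using hgF x
      have h2 := norm_le_norm_add_norm_sub' (g x) (F x)
      linarith [hM x]
    let χ : ContDiffBump (0 : E) := ⟨M + 1, M + 2, by linarith, by linarith⟩
    obtain ⟨x, hx⟩ := ContDiff.exists_fixedPoint_of_hasCompactSupport
      (F := fun x => χ x • g x) (χ.contDiff.smul hg) χ.hasCompactSupport.smul_right
    have hxM : x ∈ closedBall (0 : E) (M + 1) := by
      rw [mem_closedBall_zero_iff, ← hx, norm_smul, Real.norm_of_nonneg χ.nonneg]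
      exact (mul_le_of_le_one_left (norm_nonneg _) χ.le_one).trans (hgM x)
    refine ⟨x, hxM, ?_⟩
    have hgx : g x = x := by simpa [χ.one_of_mem_closedBall hxM] using hx
    have := hgF x
    rwa [hgx, dist_comm, dist_eq_norm] at this
  obtain ⟨x, -, hx⟩ := (isCompact_closedBall (0 : E) (M + 1)).exists_isMinOn
    ⟨0, mem_closedBall_self (by linarith)⟩ (f := fun x => ‖F x - x‖) (by fun_prop)
  refine ⟨x, ?_⟩
  by_contra hne
  have hpos : 0 < ‖F x - x‖ := norm_pos_iff.2 (sub_ne_zero.2 hne)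
  obtain ⟨y, hy, hlt⟩ := happrox (min ‖F x - x‖ 1) (by positivity) (min_le_right _ _)
  exact (hlt.trans_le (min_le_left _ _)).not_ge (hx hy)

end

/-- Solvability of Runge--Kutta methods (Proposition 4.2). -/
theorem stmt_1 (n s d : ℕ) (hn : 1 ≤ n) (hs : 1 ≤ s)
    (V : Fin (d + 1) → EuclideanSpace ℝ (Fin n) → EuclideanSpace ℝ (Fin n))
    (hVc : ∀ i, Continuous (V i)) (ν : ℝ)
    (hV : ∀ i y, ‖V i y‖ ≤ ν)
    (a : Fin s → Fin s → ℝ) (c : ℝ) (ha : ∀ α β, |a α β| ≤ c)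
    (Y : EuclideanSpace ℝ (Fin n)) (ξ : Fin (d + 1) → ℝ) :
    ∃ Z : Fin s → EuclideanSpace ℝ (Fin n),
      (∀ α, Z α = Y + ∑ β, a α β • ∑ i, ξ i • V i (Z β)) ∧
      Real.sqrt (∑ α, ‖Z α‖ ^ 2) ≤
        Real.sqrt s * ‖Y‖ + (s : ℝ) ^ 2 * c * ν * ∑ i, |ξ i| + 1 := by
  have hν : 0 ≤ ν := (norm_nonneg _).trans (hV 0 0)
  have hc : 0 ≤ c := (abs_nonneg _).trans (ha ⟨0, hs⟩ ⟨0, hs⟩)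
  set S := ∑ i, |ξ i|
  have hS : 0 ≤ S := Finset.sum_nonneg fun i _ => abs_nonneg _
  let T (Z : Fin s → EuclideanSpace ℝ (Fin n)) (α : Fin s) : EuclideanSpace ℝ (Fin n) :=
    Y + ∑ β, a α β • ∑ i, ξ i • V i (Z β)
  set B := ‖Y‖ + s * c * ν * S with hB
  have hB0 : 0 ≤ B := by positivity
  have hT (Z : Fin s → EuclideanSpace ℝ (Fin n)) (α : Fin s) : ‖T Z α‖ ≤ B := by
    have h1 (β : Fin s) : ‖∑ i, ξ i • V i (Z β)‖ ≤ S * ν := by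
      refine (norm_sum_le _ _).trans ?_
      rw [Finset.sum_mul]
      refine Finset.sum_le_sum fun i _ => ?_
      rw [norm_smul, Real.norm_eq_abs]
      gcongr
      exact hV i _
    have h2 : ‖∑ β, a α β • ∑ i, ξ i • V i (Z β)‖ ≤ ∑ _β : Fin s, c * (S * ν) := by
      refine (norm_sum_le _ _).trans (Finset.sum_le_sum fun β _ => ?_)
      rw [norm_smul, Real.norm_eq_abs]
      gcongr
      · exact ha α β
      · exact h1 β
    calc ‖T Z α‖ ≤ ‖Y‖ + ∑ _β : Fin s, c * (S * ν) := (norm_add_le _ _).trans (by gcongr)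
      _ = B := by simp [hB]; ring
  have hnorm (Z : Fin s → EuclideanSpace ℝ (Fin n)) :
      √(∑ α, ‖T Z α‖ ^ 2) ≤ √s * B := by
    calc √(∑ α, ‖T Z α‖ ^ 2) ≤ √(∑ _α : Fin s, B ^ 2) := by
          gcongr with α
          exact hT Z α
      _ = √s * B := by simp [Real.sqrt_sq hB0]
  obtain ⟨Z, hZ⟩ := Continuous.exists_fixedPoint_of_bounded
    (E := PiLp 2 fun _ : Fin s => EuclideanSpace ℝ (Fin n))
    (F := fun Z => WithLp.toLp 2 (T Z.ofLp))
    ((PiLp.continuous_toLp 2 _).comp (by fun_prop)) (M := √s * B)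
    (fun Z => by rw [PiLp.norm_eq_of_L2]; exact hnorm Z.ofLp)
  have hfix : T Z.ofLp = Z.ofLp := congrArg WithLp.ofLp hZ
  refine ⟨Z.ofLp, fun α => (congrFun hfix α).symm, ?_⟩
  have h := hnorm Z.ofLp
  rw [hfix] at h
  have hs1 : √(s : ℝ) ≤ s := by
    rw [Real.sqrt_le_left (by positivity)]
    exact_mod_cast Nat.le_self_pow two_ne_zero s
  calc _ ≤ √s * ‖Y‖ + √s * (s * c * ν * S) := by rw [← mul_add]; exact h
    _ ≤ √s * ‖Y‖ + s * (s * c * ν * S) := by gcongr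
    _ ≤ _ := by nlinarith
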